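/- Let R = 𝔽₂[X, Y, W]/(X·W) be the quotient of the polynomial ring in three variables over the field with two elements by the ideal generated by X·W, and let x, y, w denote the images of X, Y, W in R. Then w ≠ 0 in R and x·y + w ≠ 0 in R; consequently, for every c ∈ 𝔽₂ one has c·x·y + x·y + w ≠ 0 in R, i.e., the equation n₁·y = x·y + w has no solution with n₁ ∈ {0, x}. -/

import Mathlib

open MvPolynomial

/-- The ideal `(X·W)` in `𝔽₂[X, Y, W]` (variables `X 0, X 1, X 2` standing for
`x, y, w`). -/
noncomputable def s4Ideal : Ideal (MvPolynomial (Fin 3) (ZMod 2)) :=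
  Ideal.span ({X 0 * X 2} : Set (MvPolynomial (Fin 3) (ZMod 2)))

/-- The mod-2 cohomology ring of `BS₄`: `𝔽₂[x, y, w]/(x·w)`. -/
abbrev S4CohomologyRing : Type :=
  MvPolynomial (Fin 3) (ZMod 2) ⧸ s4Ideal

/-- The image `x` of `X` in the quotient ring. -/
noncomputable def xCl : S4CohomologyRing := Ideal.Quotient.mk s4Ideal (X 0)

/-- The image `y` of `Y` in the quotient ring. -/
noncomputable def yCl : S4CohomologyRing := Ideal.Quotient.mk s4Ideal (X 1)

/-- The image `w` of `W` in the quotient ring. -/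
noncomputable def wCl : S4CohomologyRing := Ideal.Quotient.mk s4Ideal (X 2)

/-- Evaluation at `x = 0, y = 0, w = 1`. -/
theorem exists_s4Eval : ∃ f : S4CohomologyRing →+* ZMod 2, f xCl = 0 ∧ f wCl = 1 := by
  refine ⟨Ideal.Quotient.lift s4Ideal (MvPolynomial.eval (![0, 0, 1] : Fin 3 → ZMod 2)) ?_, ?_, ?_⟩
  · intro a ha
    obtain ⟨b, rfl⟩ := Ideal.mem_span_singleton.1 ha
    simp
  · simp [xCl]
  · simp [wCl]

/-- In `𝔽₂[x, y, w]/(xw)` one has `w ≠ 0` and `x·y + w ≠ 0`; consequently for every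
`c ∈ 𝔽₂`, `c·x·y + x·y + w ≠ 0`, i.e. the equation `n₁·y = x·y + w` has no solution
with `n₁ ∈ {0, x}`. -/
theorem s4_consistency_obstruction :
    wCl ≠ 0 ∧ xCl * yCl + wCl ≠ 0 ∧
    (∀ c : ZMod 2,
      (Ideal.Quotient.mk s4Ideal (C c : MvPolynomial (Fin 3) (ZMod 2))) * xCl * yCl
        + xCl * yCl + wCl ≠ 0) ∧
    (∀ n₁ ∈ ({0, xCl} : Set S4CohomologyRing), n₁ * yCl ≠ xCl * yCl + wCl) := by
  obtain ⟨f, hx, hw⟩ := exists_s4Eval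
  refine ⟨fun h => ?_, fun h => ?_, fun c h => ?_, fun n hn h => ?_⟩
  · simpa [hx, hw] using congrArg f h
  · simpa [hx, hw] using congrArg f h
  · have := congrArg f h
    simp only [map_add, map_mul, hx, hw, map_zero] at this
    simp at this
  · have := congrArg f h
    rcases hn with rfl | rfl <;> simp [hx, hw] at this
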